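/- arXiv:2212.13604 — 2 statements merged into one kernel-verified Lean document; each statement's English description precedes it below -/
import Mathlib

section
/- Let S be a compact metric space equipped with its Borel σ-algebra. For each m ∈ ℕ, let n(m) ≥ 1, let q_m : Fin (n(m)) → ProbabilityMeasure S be a finite family of Borel probability measures on S, let w_m : Fin (n(m)) → ℝ≥0 be weights with ∑_i w_m(i) = 1, and let p_m be the probability measure p_m = ∑_i w_m(i) • q_m(i). Suppose the sequence (p_m) converges weakly to a probability measure p_∞, and let A ⊆ S be a measurable set with p_∞(A) < 1. Then there exist a strictly increasing function φ : ℕ → ℕ, a selection j(m) ∈ Fin (n(φ(m))) for every m, and a probability measure p'_∞ on S such that the sequence (q_{φ(m)}(j(m)))_{m∈ℕ} converges weakly to p'_∞ and p'_∞(A) < 1. -/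
open MeasureTheory Filter

/-- If a convex combination of measures gives a set mass greater than `r`, so does one of the
measures being combined. -/
theorem exists_lt_measure_of_lt_sum_smul {α ι : Type*} [MeasurableSpace α] [Fintype ι]
    {w : ι → NNReal} (hw : ∑ i, w i = 1) {μ : ι → Measure α} {s : Set α} {r : ENNReal}
    (hr : r < (∑ i, w i • μ i) s) : ∃ i, r < μ i s := by
  by_contra! h
  refine hr.not_ge ?_
  calc (∑ i, w i • μ i) s = ∑ i, (w i : ENNReal) * μ i s := by
        simp only [Measure.finsetSum_apply, Measure.smul_apply, ENNReal.smul_def, smul_eq_mul]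
    _ ≤ ∑ i, (w i : ENNReal) * r := by gcongr with i; exact h i
    _ = r := by rw [← Finset.sum_mul, ← ENNReal.ofNNReal_finsetSum, hw]; simp

/-- If weakly convergent probability measures give mass at least `r` to closed thickenings, of radii
tending to zero, of a closed set, then the limit gives mass at least `r` to that set. -/
theorem le_measure_of_tendsto_of_le_measure_cthickening {S : Type*} [PseudoMetricSpace S]
    [MeasurableSpace S] [OpensMeasurableSpace S] {μ : ℕ → ProbabilityMeasure S}
    {ν : ProbabilityMeasure S} (hμ : Tendsto μ atTop (nhds ν)) {F : Set S} (hF : IsClosed F)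
    {δ : ℕ → ℝ} (hδ : Tendsto δ atTop (nhds 0)) {r : ENNReal}
    (hr : ∀ m, r ≤ (μ m : Measure S) (Metric.cthickening (δ m) F)) :
    r ≤ (ν : Measure S) F := by
  have hlim : Tendsto (fun t => (ν : Measure S) (Metric.cthickening t F))
      (nhdsWithin 0 (Set.Ioi 0)) (nhds ((ν : Measure S) F)) :=
    (tendsto_measure_cthickening_of_isClosed ⟨1, one_pos, measure_ne_top _ _⟩ hF).mono_left
      nhdsWithin_le_nhds
  refine ge_of_tendsto hlim (eventually_mem_nhdsWithin.mono fun t ht => ?_)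
  refine le_trans ?_ (ProbabilityMeasure.limsup_measure_closed_le_of_tendsto hμ
    (Metric.isClosed_cthickening (δ := t) (E := F)))
  refine le_limsup_of_frequently_le (Eventually.frequently ?_)
  filter_upwards [hδ.eventually_lt_const ht] with m hm
  exact (hr m).trans (measure_mono (Metric.cthickening_mono hm.le F))

/-- **Measure-theoretic selection lemma** (Lemma 4.3.5 of the paper).
If a sequence of convex combinations of probability measures on a compact metric
space converges weakly to `pLim`, and `A` is a measurable set with `pLim A < 1`, then
one can select, along a subsequence, one of the generating measures in each convex
combination so that the selected measures converge weakly to a limit `pLim'` with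
`pLim' A < 1`. -/
theorem selection_lemma {S : Type*} [MetricSpace S] [CompactSpace S]
    [MeasurableSpace S] [BorelSpace S]
    (n : ℕ → ℕ) (hn : ∀ m, 1 ≤ n m)
    (q : ∀ m, Fin (n m) → ProbabilityMeasure S)
    (w : ∀ m, Fin (n m) → NNReal) (hw : ∀ m, ∑ i, w m i = 1)
    (p : ℕ → ProbabilityMeasure S)
    (hp : ∀ m, (p m : Measure S) = ∑ i, w m i • (q m i : Measure S))
    (pLim : ProbabilityMeasure S)
    (hconv : Tendsto p atTop (nhds pLim))
    (A : Set S) (hA : MeasurableSet A) (hA1 : pLim A < 1) :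
    ∃ φ : ℕ → ℕ, StrictMono φ ∧
      ∃ j : ∀ m : ℕ, Fin (n (φ m)), ∃ pLim' : ProbabilityMeasure S,
        Tendsto (fun m => q (φ m) (j m)) atTop (nhds pLim') ∧ pLim' A < 1 := by
  obtain ⟨F, hFA, hF, hF0⟩ : ∃ F ⊆ Aᶜ, IsClosed F ∧ 0 < (pLim : Measure S) F := by
    refine hA.compl.exists_lt_isClosed_of_ne_top (measure_ne_top _ _) (pos_iff_ne_zero.2 ?_)
    rw [Ne, prob_compl_eq_zero_iff hA, ← pLim.ennreal_coeFn_eq_coeFn_toMeasure]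
    exact_mod_cast hA1.ne
  obtain ⟨r, hr0, hrF⟩ := exists_between hF0
  obtain ⟨δ, -, hδ0, hδ⟩ := exists_seq_strictAnti_tendsto (0 : ℝ)
  obtain ⟨φ, hφ, hφr⟩ : ∃ φ : ℕ → ℕ, StrictMono φ ∧
      ∀ k, r < (p (φ k) : Measure S) (Metric.thickening (δ k) F) := by
    refine extraction_forall_of_eventually
      (P := fun k m => r < (p m : Measure S) (Metric.thickening (δ k) F))
      fun k => eventually_lt_of_lt_liminf ?_
    calc r < (pLim : Measure S) F := hrF
      _ ≤ (pLim : Measure S) (Metric.thickening (δ k) F) :=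
        measure_mono (Metric.self_subset_thickening (hδ0 k) F)
      _ ≤ _ := ProbabilityMeasure.le_liminf_measure_open_of_tendsto hconv Metric.isOpen_thickening
  have hsel : ∀ k, ∃ i, r < (q (φ k) i : Measure S) (Metric.thickening (δ k) F) := fun k =>
    exists_lt_measure_of_lt_sum_smul (hw (φ k)) (hp (φ k) ▸ hφr k)
  choose j hj using hsel
  obtain ⟨ν, ψ, hψ, hν⟩ := CompactSpace.tendsto_subseq fun k => q (φ k) (j k)
  refine ⟨φ ∘ ψ, hφ.comp hψ, fun m => j (ψ m), ν, hν, ?_⟩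
  have hνF : r ≤ (ν : Measure S) F :=
    le_measure_of_tendsto_of_le_measure_cthickening hν hF (hδ.comp hψ.tendsto_atTop) fun m =>
      (hj (ψ m)).le.trans (measure_mono (Metric.thickening_subset_cthickening _ _))
  refine lt_of_le_of_ne (ν.apply_le_one A) fun h => ?_
  have hνA : (ν : Measure S) Aᶜ = 0 := by
    rw [prob_compl_eq_zero_iff hA, ← ν.ennreal_coeFn_eq_coeFn_toMeasure, h, ENNReal.coe_one]
  exact (hr0.trans_le hνF).ne' (measure_mono_null hFA hνA)
end

section
/- Let P be a nonzero polynomial in two real variables which is homogeneous of degree m ≥ 1 and harmonic, i.e. ∂²P/∂x² + ∂²P/∂y² = 0 as polynomials. Then P assumes both positive and negative values in every neighbourhood of the origin: for every ε > 0 there exist points u, v ∈ ℝ² with ‖u‖ < ε, ‖v‖ < ε, P(u) > 0 and P(v) < 0. -/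
open MvPolynomial

namespace MvPolynomial

/-- A homogeneous polynomial of degree `m` scales by `t ^ m` under dilation by `t`. -/
theorem IsHomogeneous.eval_smul_point {σ R : Type*} [CommSemiring R] {P : MvPolynomial σ R} {m : ℕ}
    (hP : P.IsHomogeneous m) (t : R) (x : σ → R) : eval (t • x) P = t ^ m * eval x P := by
  rw [eval_eq, eval_eq, Finset.mul_sum]
  refine Finset.sum_congr rfl fun d hd => ?_
  have hdeg : ∑ i ∈ d.support, d i = m := by
    rw [← Finsupp.degree_apply, Finsupp.degree_eq_weight_one]
    exact hP (mem_support_iff.mp hd)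
  simp only [Pi.smul_apply, smul_eq_mul, mul_pow, Finset.prod_mul_distrib,
    Finset.prod_pow_eq_pow_sum, hdeg]
  ring

/-- The chain rule for a polynomial along a differentiable curve. -/
theorem hasDerivAt_eval_comp {σ : Type*} [Fintype σ] (P : MvPolynomial σ ℝ) {c : ℝ → σ → ℝ}
    {c' : σ → ℝ} {t : ℝ} (hc : ∀ i, HasDerivAt (fun s => c s i) (c' i) t) :
    HasDerivAt (fun s => eval (c s) P) (∑ i, c' i * eval (c t) (pderiv i P)) t := by
  classical
  induction P using MvPolynomial.induction_on with
  | C a => simpa using hasDerivAt_const t a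
  | add p q hp hq =>
    simp only [map_add, mul_add, Finset.sum_add_distrib]
    exact hp.add hq
  | mul_X p j hp =>
    simp only [map_mul, eval_X]
    refine (hp.mul (hc j)).congr_deriv ?_
    simp only [pderiv_mul, pderiv_X, map_add, map_mul, eval_X, mul_add, Finset.sum_add_distrib,
      Finset.sum_mul]
    congr 1
    · exact Finset.sum_congr rfl fun i _ => by ring
    · rw [Finset.sum_eq_single j]
      · simp [mul_comm]
      · intro i _ hij
        simp [hij.symm]
      · simp

/-- The derivative of a polynomial in two variables with respect to the polar angle. -/
noncomputable def angularDeriv {R : Type*} [CommRing R] (P : MvPolynomial (Fin 2) R) :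
    MvPolynomial (Fin 2) R :=
  X 0 * pderiv 1 P - X 1 * pderiv 0 P

/-- Homogeneous harmonic polynomials are eigenvectors of the square of the angular derivative. -/
theorem angularDeriv_angularDeriv_of_harmonic {R : Type*} [CommRing R]
    {P : MvPolynomial (Fin 2) R} {m : ℕ} (hhom : P.IsHomogeneous m)
    (hharm : pderiv 0 (pderiv 0 P) + pderiv 1 (pderiv 1 P) = 0) :
    angularDeriv (angularDeriv P) = -((m : MvPolynomial (Fin 2) R) ^ 2 * P) := by
  have euler : X 0 * pderiv 0 P + X 1 * pderiv 1 P = (m : MvPolynomial (Fin 2) R) * P := by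
    simpa using hhom.sum_X_mul_pderiv
  have euler₀ := congrArg (pderiv 0) euler
  have euler₁ := congrArg (pderiv 1) euler
  simp only [map_add, pderiv_mul, pderiv_X_self, Derivation.map_natCast,
    pderiv_X_of_ne (zero_ne_one (α := Fin 2)),
    pderiv_X_of_ne (one_ne_zero (α := Fin 2))] at euler₀ euler₁
  simp only [angularDeriv, map_sub, pderiv_mul, pderiv_X_self,
    pderiv_X_of_ne (zero_ne_one (α := Fin 2)),
    pderiv_X_of_ne (one_ne_zero (α := Fin 2))]
  linear_combination (X 0 ^ 2 + X 1 ^ 2) * hharm - X 0 * euler₀ - X 1 * euler₁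
    - (m : MvPolynomial (Fin 2) R) * euler

/-- The rotation of the plane by the angle `θ`. -/
noncomputable def planeRotation (u : Fin 2 → ℝ) (θ : ℝ) : Fin 2 → ℝ :=
  ![u 0 * Real.cos θ - u 1 * Real.sin θ, u 0 * Real.sin θ + u 1 * Real.cos θ]

theorem hasDerivAt_eval_planeRotation (P : MvPolynomial (Fin 2) ℝ) (u : Fin 2 → ℝ) (θ : ℝ) :
    HasDerivAt (fun s => eval (planeRotation u s) P)
      (eval (planeRotation u θ) (angularDeriv P)) θ := by
  have hcos := Real.hasDerivAt_cos θ
  have hsin := Real.hasDerivAt_sin θ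
  have hc : ∀ i, HasDerivAt (fun s => planeRotation u s i)
      ((![-planeRotation u θ 1, planeRotation u θ 0] : Fin 2 → ℝ) i) θ := by
    intro i
    fin_cases i
    · refine ((hcos.const_mul (u 0)).sub (hsin.const_mul (u 1))).congr_deriv ?_
      simp [planeRotation]
      ring
    · refine ((hsin.const_mul (u 0)).add (hcos.const_mul (u 1))).congr_deriv ?_
      simp [planeRotation]
      ring
  refine (hasDerivAt_eval_comp P hc).congr_deriv ?_
  simp [angularDeriv]
  ring

/-- A homogeneous harmonic polynomial of degree `m` changes sign under rotation by `π / m`. -/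
theorem eval_planeRotation_pi_div {P : MvPolynomial (Fin 2) ℝ} {m : ℕ} (hm : m ≠ 0)
    (hhom : P.IsHomogeneous m)
    (hharm : pderiv 0 (pderiv 0 P) + pderiv 1 (pderiv 1 P) = 0) (u : Fin 2 → ℝ) :
    eval (planeRotation u (Real.pi / m)) P = -eval u P := by
  have hm' : (m : ℝ) ≠ 0 := Nat.cast_ne_zero.mpr hm
  let g : ℝ → ℝ := fun s => m * (eval (planeRotation u s) P * Real.cos (m * s)) -
    eval (planeRotation u s) (angularDeriv P) * Real.sin (m * s)
  have hg : ∀ s, HasDerivAt g 0 s := by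
    intro s
    have hlin : HasDerivAt (fun s : ℝ => (m : ℝ) * s) m s := by
      simpa using (hasDerivAt_id s).const_mul (m : ℝ)
    have hP := hasDerivAt_eval_planeRotation P u s
    have hQ := hasDerivAt_eval_planeRotation (angularDeriv P) u s
    rw [angularDeriv_angularDeriv_of_harmonic hhom hharm] at hQ
    refine (((hP.mul hlin.cos).const_mul (m : ℝ)).sub (hQ.mul hlin.sin)).congr_deriv ?_
    simp only [map_neg, map_mul, map_pow, map_natCast]
    ring
  have hconst : g (Real.pi / m) = g 0 :=
    is_const_of_deriv_eq_zero (fun s => (hg s).differentiableAt) (fun s => (hg s).deriv) _ _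
  have hzero : planeRotation u 0 = u := by
    ext i
    fin_cases i <;> simp [planeRotation]
  simp only [g, mul_div_cancel₀ _ hm', Real.cos_pi, Real.sin_pi, mul_zero, Real.cos_zero,
    Real.sin_zero, hzero, sub_zero, mul_one] at hconst
  apply mul_left_cancel₀ hm'
  linarith

end MvPolynomial


open MvPolynomial

/-- The fact about harmonic polynomials used in the proof of the strong
maximum principle (Lemma 2.5.6 of the paper): a nonzero homogeneous harmonic
polynomial of degree `m ≥ 1` in two real variables assumes both positive and
negative values in every neighbourhood of the origin. -/
theorem harmonic_homogeneous_pos_and_neg_values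
    (P : MvPolynomial (Fin 2) ℝ) (hP : P ≠ 0)
    (m : ℕ) (hm : 1 ≤ m) (hhom : P.IsHomogeneous m)
    (hharm : pderiv 0 (pderiv 0 P) + pderiv 1 (pderiv 1 P) = 0) :
    ∀ ε : ℝ, 0 < ε → ∃ u v : Fin 2 → ℝ,
      ‖u‖ < ε ∧ ‖v‖ < ε ∧ 0 < eval u P ∧ eval v P < 0 := by
  have scale : ∀ w : Fin 2 → ℝ, ∀ ε : ℝ, 0 < ε →
      ∃ t : ℝ, 0 < t ∧ ‖t • w‖ < ε := by
    intro w ε hε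
    have hw : 0 < ‖w‖ + 1 := by positivity
    refine ⟨ε / (‖w‖ + 1), by positivity, ?_⟩
    rw [norm_smul, Real.norm_of_nonneg (by positivity), div_mul_eq_mul_div, div_lt_iff₀ hw]
    exact mul_lt_mul_of_pos_left (lt_add_one _) hε
  have signs : ∃ a b : Fin 2 → ℝ, 0 < eval a P ∧ eval b P < 0 := by
    obtain ⟨w, hw⟩ : ∃ w : Fin 2 → ℝ, eval w P ≠ 0 := by
      by_contra! h
      exact hP (MvPolynomial.funext fun x => by simpa using h x)
    have hrot := eval_planeRotation_pi_div (by omega : m ≠ 0) hhom hharm w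
    rcases hw.lt_or_gt with h | h
    · exact ⟨_, w, by rw [hrot]; linarith, h⟩
    · exact ⟨w, _, h, by rw [hrot]; linarith⟩
  intro ε hε
  obtain ⟨a, b, ha, hb⟩ := signs
  obtain ⟨s, hs, hsa⟩ := scale a ε hε
  obtain ⟨t, ht, htb⟩ := scale b ε hε
  refine ⟨s • a, t • b, hsa, htb, ?_, ?_⟩
  · rw [hhom.eval_smul_point]
    positivity
  · rw [hhom.eval_smul_point]
    exact mul_neg_of_pos_of_neg (pow_pos ht m) hb
end
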